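/- arXiv:0711.2867 — 2 statements merged into one kernel-verified Lean document; each statement's English description precedes it below -/
import Mathlib

section
/- Suppose Ī is nonempty. If E_in(I) ≠ ∅, then every node j ∈ Ī attaining the maximum max_{k ∈ Ī} v_k is a parent of I, i.e. there exists ℓ ∈ I with (j,ℓ) ∈ E. If E_in(I) = ∅, then v_j = 0 for every j ∈ Ī. -/
open Matrix Finset

/-- Outdegree of node `i` in the edge set `E`. -/
def outdeg {n : ℕ} (E : Finset (Fin n × Fin n)) (i : Fin n) : ℕ :=
  (Finset.univ.filter (fun j => (i, j) ∈ E)).card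

/-- The scaled adjacency matrix `P` of the graph: `P i j = 1 / outdeg i` if `(i,j) ∈ E`. -/
noncomputable def Pmat {n : ℕ} (E : Finset (Fin n × Fin n)) : Matrix (Fin n) (Fin n) ℝ :=
  fun i j => if (i, j) ∈ E then ((outdeg E i : ℝ))⁻¹ else 0

/-- Indicator vector of a set of nodes. -/
def ind {n : ℕ} (I : Finset (Fin n)) : Fin n → ℝ :=
  fun i => if i ∈ I then 1 else 0

/-- `v = (Id - cP)⁻¹ e_I`, the vector of mean numbers of visits to `I` before zapping. -/
noncomputable def vvec {n : ℕ} (c : ℝ) (E : Finset (Fin n × Fin n)) (I : Finset (Fin n)) : Fin n → ℝ :=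
  (1 - c • Pmat E)⁻¹ *ᵥ ind I

/-- PageRank vector `πᵀ = (1-c) zᵀ (Id - cP)⁻¹`. -/
noncomputable def pr {n : ℕ} (c : ℝ) (z : Fin n → ℝ) (E : Finset (Fin n × Fin n)) : Fin n → ℝ :=
  (1 - c) • (((1 - c • Pmat E)⁻¹)ᵀ *ᵥ z)

/-- PageRank of the set `I`: `πᵀ e_I`. -/
noncomputable def prSet {n : ℕ} (c : ℝ) (z : Fin n → ℝ) (E : Finset (Fin n × Fin n))
    (I : Finset (Fin n)) : ℝ :=
  ∑ i ∈ I, pr c z E i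

/-- Node `i` has access to (some node of) the set `J`: `i ∈ J` or a directed path from `i`
reaches `J`. -/
def access {n : ℕ} (E : Finset (Fin n × Fin n)) (i : Fin n) (J : Finset (Fin n)) : Prop :=
  ∃ j ∈ J, Relation.ReflTransGen (fun a b => (a, b) ∈ E) i j

theorem aux_row {n : ℕ} (E : Finset (Fin n × Fin n)) (hE : ∀ i, 0 < outdeg E i) (i : Fin n) :
    ∑ j, Pmat E i j = 1 := by
  have h : (outdeg E i : ℝ) ≠ 0 := by exact_mod_cast (hE i).ne'
  simp only [Pmat]
  rw [← Finset.sum_filter, Finset.sum_const, nsmul_eq_mul]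
  exact mul_inv_cancel₀ h

theorem aux_nonneg {n : ℕ} (E : Finset (Fin n × Fin n)) (i j : Fin n) : 0 ≤ Pmat E i j := by
  unfold Pmat
  split_ifs <;> positivity

theorem aux_det {n : ℕ} (E : Finset (Fin n × Fin n)) (hE : ∀ i, 0 < outdeg E i)
    (c : ℝ) (hc0 : 0 < c) (hc1 : c < 1) : (1 - c • Pmat E).det ≠ 0 := by
  apply det_ne_zero_of_sum_row_lt_diag
  intro k
  have h1 : ∑ j ∈ Finset.univ.erase k, ‖(1 - c • Pmat E) k j‖
      = ∑ j ∈ Finset.univ.erase k, c * Pmat E k j := by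
    apply Finset.sum_congr rfl
    intro j hj
    have hkj : k ≠ j := (Finset.ne_of_mem_erase hj).symm
    simp only [Matrix.sub_apply, Matrix.one_apply_ne hkj, Matrix.smul_apply, smul_eq_mul,
      zero_sub, norm_neg, Real.norm_eq_abs]
    exact abs_of_nonneg (mul_nonneg hc0.le (aux_nonneg E k j))
  have h2 : Pmat E k k + ∑ j ∈ Finset.univ.erase k, Pmat E k j = 1 := by
    rw [Finset.add_sum_erase _ _ (Finset.mem_univ k), aux_row E hE]
  rw [h1, ← Finset.mul_sum]
  refine lt_of_lt_of_le ?_ (le_abs_self _)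
  simp only [Matrix.sub_apply, Matrix.one_apply_eq, Matrix.smul_apply, smul_eq_mul]
  nlinarith

theorem aux_eq {n : ℕ} (E : Finset (Fin n × Fin n)) (hE : ∀ i, 0 < outdeg E i)
    (c : ℝ) (hc0 : 0 < c) (hc1 : c < 1) (I : Finset (Fin n)) (i : Fin n) :
    vvec c E I i = c * ∑ j, Pmat E i j * vvec c E I j + ind I i := by
  have h : (1 - c • Pmat E) *ᵥ vvec c E I = ind I := by
    unfold vvec
    rw [Matrix.mulVec_mulVec, Matrix.mul_nonsing_inv _ (aux_det E hE c hc0 hc1).isUnit,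
      Matrix.one_mulVec]
  have h2 := congrFun h i
  rw [Matrix.sub_mulVec, Matrix.one_mulVec, Matrix.smul_mulVec] at h2
  simp only [Pi.sub_apply, Pi.smul_apply, smul_eq_mul, Matrix.mulVec, dotProduct] at h2
  linarith

theorem aux_vnonneg {n : ℕ} (E : Finset (Fin n × Fin n)) (hE : ∀ i, 0 < outdeg E i)
    (c : ℝ) (hc0 : 0 < c) (hc1 : c < 1) (I : Finset (Fin n)) (i : Fin n) :
    0 ≤ vvec c E I i := by
  obtain ⟨k, -, hk⟩ := Finset.exists_min_image Finset.univ (vvec c E I) ⟨i, Finset.mem_univ i⟩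
  refine le_trans ?_ (hk i (Finset.mem_univ i))
  have h1 : vvec c E I k ≤ ∑ j, Pmat E k j * vvec c E I j := by
    calc vvec c E I k = ∑ j, Pmat E k j * vvec c E I k := by
          rw [← Finset.sum_mul, aux_row E hE, one_mul]
      _ ≤ _ := Finset.sum_le_sum fun j hj =>
          mul_le_mul_of_nonneg_left (hk j hj) (aux_nonneg E k j)
  have h2 := aux_eq E hE c hc0 hc1 I k
  have h3 : 0 ≤ ind I k := by unfold ind; split_ifs <;> norm_num
  have h4 := mul_le_mul_of_nonneg_left h1 hc0.le
  by_contra hneg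
  push Not at hneg
  nlinarith

theorem aux_max {n : ℕ} (E : Finset (Fin n × Fin n)) (hE : ∀ i, 0 < outdeg E i)
    (c : ℝ) (hc0 : 0 < c) (hc1 : c < 1) (I : Finset (Fin n)) (k : Fin n) (hkI : k ∉ I)
    (hl : ∀ l ∈ I, (k, l) ∉ E) (hmax : ∀ j ∉ I, vvec c E I j ≤ vvec c E I k) :
    vvec c E I k ≤ 0 := by
  have h1 : ∑ j, Pmat E k j * vvec c E I j ≤ vvec c E I k := by
    calc _ ≤ ∑ j, Pmat E k j * vvec c E I k := by
          refine Finset.sum_le_sum fun j _ => ?_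
          by_cases hj : j ∈ I
          · have h0 : Pmat E k j = 0 := by simp [Pmat, hl j hj]
            simp [h0]
          · exact mul_le_mul_of_nonneg_left (hmax j hj) (aux_nonneg E k j)
      _ = _ := by rw [← Finset.sum_mul, aux_row E hE, one_mul]
  have h2 := aux_eq E hE c hc0 hc1 I k
  have h3 : ind I k = 0 := by simp [ind, hkI]
  have h4 := mul_le_mul_of_nonneg_left h1 hc0.le
  by_contra hneg
  push Not at hneg
  nlinarith

theorem aux_pos {n : ℕ} (E : Finset (Fin n × Fin n)) (hE : ∀ i, 0 < outdeg E i)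
    (c : ℝ) (hc0 : 0 < c) (hc1 : c < 1) (I : Finset (Fin n)) (a b : Fin n) (hb : b ∈ I)
    (hab : (a, b) ∈ E) : 0 < vvec c E I a := by
  have hs : ∀ i, 0 ≤ ∑ j, Pmat E i j * vvec c E I j := fun i =>
    Finset.sum_nonneg fun j _ => mul_nonneg (aux_nonneg E i j) (aux_vnonneg E hE c hc0 hc1 I j)
  have hvb : 0 < vvec c E I b := by
    have h3 : ind I b = 1 := by simp [ind, hb]
    rw [aux_eq E hE c hc0 hc1 I b, h3]
    have := mul_nonneg hc0.le (hs b)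
    linarith
  have hp : 0 < Pmat E a b := by
    have : (0 : ℝ) < outdeg E a := by exact_mod_cast hE a
    simp only [Pmat, hab, if_true]
    positivity
  have h3 : 0 ≤ ind I a := by unfold ind; split_ifs <;> norm_num
  have h5 : Pmat E a b * vvec c E I b ≤ ∑ j, Pmat E a j * vvec c E I j :=
    Finset.single_le_sum (f := fun j => Pmat E a j * vvec c E I j)
      (fun j _ => mul_nonneg (aux_nonneg E a j) (aux_vnonneg E hE c hc0 hc1 I j))
      (Finset.mem_univ b)
  have h6 : 0 < c * ∑ j, Pmat E a j * vvec c E I j :=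
    mul_pos hc0 (lt_of_lt_of_le (mul_pos hp hvb) h5)
  rw [aux_eq E hE c hc0 hc1 I a]
  linarith

/-- Lemma 2 (Parents of I): if the set of external inlinks of `I` is nonempty, every node
of the complement of `I` attaining `max_{k ∉ I} v k` is a parent of `I`; if it is empty,
then `v j = 0` for every `j ∉ I`. -/
theorem stmt3 {n : ℕ} (hn : 1 ≤ n) (E : Finset (Fin n × Fin n))
    (hE : ∀ i, 0 < outdeg E i) (c : ℝ) (hc0 : 0 < c) (hc1 : c < 1)
    (I : Finset (Fin n)) (hIc : (Iᶜ : Finset (Fin n)).Nonempty) :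
    ((E.filter (fun p => p.1 ∉ I ∧ p.2 ∈ I)).Nonempty →
      ∀ j ∈ Iᶜ, vvec c E I j = (Iᶜ : Finset (Fin n)).sup' hIc (vvec c E I) →
        ∃ ℓ ∈ I, (j, ℓ) ∈ E) ∧
    (E.filter (fun p => p.1 ∉ I ∧ p.2 ∈ I) = ∅ →
      ∀ j ∈ Iᶜ, vvec c E I j = 0) := by
  constructor
  · rintro ⟨⟨a, b⟩, hab⟩ j hj hmax
    simp only [Finset.mem_filter] at hab
    obtain ⟨habE, ha, hb⟩ := hab
    by_contra hno
    push Not at hno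
    have hle : ∀ k ∉ I, vvec c E I k ≤ vvec c E I j := fun k hk => by
      rw [hmax]
      exact Finset.le_sup' (vvec c E I) (Finset.mem_compl.2 hk)
    have h1 := aux_max E hE c hc0 hc1 I j (Finset.mem_compl.1 hj) hno hle
    have h2 := aux_pos E hE c hc0 hc1 I a b hb habE
    have h3 := hle a ha
    linarith
  · intro hemp j hj
    obtain ⟨k, hk, hkmax⟩ := Finset.exists_max_image Iᶜ (vvec c E I) hIc
    have hkI := Finset.mem_compl.1 hk
    have hno : ∀ l ∈ I, (k, l) ∉ E := fun l hl hkl => by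
      have : (k, l) ∈ E.filter (fun p => p.1 ∉ I ∧ p.2 ∈ I) :=
        Finset.mem_filter.2 ⟨hkl, hkI, hl⟩
      rw [hemp] at this
      simp at this
    have h1 := aux_max E hE c hc0 hc1 I k hkI hno
      (fun m hm => hkmax m (Finset.mem_compl.2 hm))
    exact le_antisymm ((hkmax j hj).trans h1) (aux_vnonneg E hE c hc0 hc1 I j)
end

section
/- Suppose E and Ẽ differ only in the links starting from a node i. Then π̃^T e_I > π^T e_I if and only if δ^T v > 0, and π̃^T e_I = π^T e_I if and only if δ^T v = 0. -/
open Matrix Finset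

/-- The correction vector `δ` for a change of the links starting from node `i`:
`δ = Σ_{j : (i,j) ∈ Ẽ} e_j / d̃_i − Σ_{j : (i,j) ∈ E} e_j / d_i`. -/
noncomputable def delta {n : ℕ} (E Et : Finset (Fin n × Fin n)) (i : Fin n) : Fin n → ℝ :=
  fun j => (if (i, j) ∈ Et then ((outdeg Et i : ℝ))⁻¹ else 0)
         - (if (i, j) ∈ E then ((outdeg E i : ℝ))⁻¹ else 0)

lemma Pmat_nonneg {n : ℕ} (E : Finset (Fin n × Fin n)) (k j : Fin n) : 0 ≤ Pmat E k j := by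
  unfold Pmat
  split_ifs <;> positivity

lemma Pmat_row {n : ℕ} (E : Finset (Fin n × Fin n)) (hE : ∀ i, 0 < outdeg E i) (k : Fin n) :
    ∑ j, Pmat E k j = 1 := by
  have h : (outdeg E k : ℝ) ≠ 0 := by exact_mod_cast (hE k).ne'
  unfold Pmat
  rw [← Finset.sum_filter, Finset.sum_const, nsmul_eq_mul]
  exact mul_inv_cancel₀ h

lemma vecMul_M {n : ℕ} (E : Finset (Fin n × Fin n)) (c : ℝ) (x : Fin n → ℝ) (j : Fin n) :
    (x ᵥ* (1 - c • Pmat E)) j = x j - c * ∑ k, x k * Pmat E k j := by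
  rw [Matrix.vecMul_sub, Matrix.vecMul_one, Matrix.vecMul_smul]
  simp [Matrix.vecMul, dotProduct]

lemma nonneg_of_vecMul {n : ℕ} (E : Finset (Fin n × Fin n)) (hE : ∀ i, 0 < outdeg E i)
    (c : ℝ) (hc0 : 0 < c) (hc1 : c < 1) (x : Fin n → ℝ)
    (hx : ∀ j, 0 ≤ (x ᵥ* (1 - c • Pmat E)) j) (j : Fin n) : 0 ≤ x j := by
  have h1 : ∀ j, max (-x j) 0 ≤ c * ∑ k, max (-x k) 0 * Pmat E k j := by
    intro j
    have h := hx j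
    rw [vecMul_M] at h
    have h2 : -∑ k, x k * Pmat E k j ≤ ∑ k, max (-x k) 0 * Pmat E k j := by
      rw [← Finset.sum_neg_distrib]
      refine Finset.sum_le_sum fun k _ => ?_
      rw [← neg_mul]
      exact mul_le_mul_of_nonneg_right (le_max_left _ _) (Pmat_nonneg E k j)
    have h3 : 0 ≤ ∑ k, max (-x k) 0 * Pmat E k j :=
      Finset.sum_nonneg fun k _ => mul_nonneg (le_max_right _ _) (Pmat_nonneg E k j)
    refine max_le ?_ (by positivity)
    nlinarith [mul_le_mul_of_nonneg_left h2 hc0.le]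
  have h2 : ∑ j, max (-x j) 0 ≤ c * ∑ k, max (-x k) 0 := by
    calc ∑ j, max (-x j) 0 ≤ ∑ j, c * ∑ k, max (-x k) 0 * Pmat E k j :=
          Finset.sum_le_sum fun j _ => h1 j
      _ = c * ∑ k, max (-x k) 0 := by
          rw [← Finset.mul_sum, Finset.sum_comm]
          simp only [← Finset.mul_sum, Pmat_row E hE, mul_one]
  have h3 : max (-x j) 0 ≤ ∑ j, max (-x j) 0 :=
    Finset.single_le_sum (f := fun j => max (-x j) 0) (fun k _ => le_max_right _ _)
      (Finset.mem_univ j)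
  have h4 : ∑ j, max (-x j) 0 ≤ 0 := by nlinarith
  linarith [le_max_left (-x j) 0]

lemma isUnit_M {n : ℕ} (E : Finset (Fin n × Fin n)) (hE : ∀ i, 0 < outdeg E i)
    (c : ℝ) (hc0 : 0 < c) (hc1 : c < 1) : IsUnit (1 - c • Pmat E).det := by
  rw [← Matrix.isUnit_iff_isUnit_det, ← Matrix.vecMul_injective_iff_isUnit]
  intro x y hxy
  have hxy : x ᵥ* (1 - c • Pmat E) = y ᵥ* (1 - c • Pmat E) := hxy
  funext j
  have h1 := nonneg_of_vecMul E hE c hc0 hc1 (x - y)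
    (by intro j; rw [Matrix.sub_vecMul, hxy]; simp) j
  have h2 := nonneg_of_vecMul E hE c hc0 hc1 (y - x)
    (by intro j; rw [Matrix.sub_vecMul, hxy]; simp) j
  simp only [Pi.sub_apply] at h1 h2
  linarith

lemma pr_vecMul {n : ℕ} (E : Finset (Fin n × Fin n)) (hE : ∀ i, 0 < outdeg E i)
    (c : ℝ) (hc0 : 0 < c) (hc1 : c < 1) (z : Fin n → ℝ) :
    pr c z E ᵥ* (1 - c • Pmat E) = (1 - c) • z := by
  unfold pr
  rw [Matrix.mulVec_transpose, Matrix.smul_vecMul, Matrix.vecMul_vecMul,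
    Matrix.nonsing_inv_mul _ (isUnit_M E hE c hc0 hc1), Matrix.vecMul_one]

lemma M_vvec {n : ℕ} (E : Finset (Fin n × Fin n)) (hE : ∀ i, 0 < outdeg E i)
    (c : ℝ) (hc0 : 0 < c) (hc1 : c < 1) (I : Finset (Fin n)) :
    (1 - c • Pmat E) *ᵥ vvec c E I = ind I := by
  unfold vvec
  rw [Matrix.mulVec_mulVec, Matrix.mul_nonsing_inv _ (isUnit_M E hE c hc0 hc1), Matrix.one_mulVec]

lemma pr_pos {n : ℕ} (E : Finset (Fin n × Fin n)) (hE : ∀ i, 0 < outdeg E i)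
    (c : ℝ) (hc0 : 0 < c) (hc1 : c < 1) (z : Fin n → ℝ) (hz : ∀ i, 0 < z i) (j : Fin n) :
    0 < pr c z E j := by
  have hm := pr_vecMul E hE c hc0 hc1 z
  have hz' : ∀ j, 0 < ((1 - c) • z) j := fun j => mul_pos (sub_pos.2 hc1) (hz j)
  have hnn := nonneg_of_vecMul E hE c hc0 hc1 (pr c z E) (fun j => by rw [hm]; exact (hz' j).le)
  have h := hz' j
  rw [← hm, vecMul_M] at h
  have h3 : 0 ≤ c * ∑ k, pr c z E k * Pmat E k j :=
    mul_nonneg hc0.le (Finset.sum_nonneg fun k _ => mul_nonneg (hnn k) (Pmat_nonneg E k j))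
  linarith

lemma prSet_eq {n : ℕ} (c : ℝ) (z : Fin n → ℝ) (E : Finset (Fin n × Fin n))
    (I : Finset (Fin n)) : prSet c z E I = pr c z E ⬝ᵥ ind I := by
  simp [prSet, dotProduct, ind]

lemma M_diff {n : ℕ} (E Et : Finset (Fin n × Fin n)) (c : ℝ) (i : Fin n)
    (hdiff : ∀ k, k ≠ i → ∀ j, ((k, j) ∈ E ↔ (k, j) ∈ Et)) :
    Pmat Et = Pmat E + Matrix.vecMulVec (Pi.single i 1) (delta E Et i) := by
  ext k j
  by_cases hk : k = i
  · subst hk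
    simp [Matrix.vecMulVec_apply, Pmat, delta]
  · have ho : outdeg Et k = outdeg E k := by
      unfold outdeg
      simp only [hdiff k hk]
    simp [Matrix.vecMulVec_apply, Pmat, hk, ho, hdiff k hk]

lemma prSet_diff {n : ℕ} (E Et : Finset (Fin n × Fin n))
    (hE : ∀ i, 0 < outdeg E i) (hEt : ∀ i, 0 < outdeg Et i)
    (c : ℝ) (hc0 : 0 < c) (hc1 : c < 1) (z : Fin n → ℝ)
    (I : Finset (Fin n)) (i : Fin n)
    (hdiff : ∀ k, k ≠ i → ∀ j, ((k, j) ∈ E ↔ (k, j) ∈ Et)) :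
    prSet c z Et I = prSet c z E I + c * pr c z Et i * (delta E Et i ⬝ᵥ vvec c E I) := by
  have hM : 1 - c • Pmat E = (1 - c • Pmat Et)
      + c • Matrix.vecMulVec (Pi.single i 1) (delta E Et i) := by
    rw [M_diff E Et c i hdiff, smul_add]; abel
  rw [prSet_eq, prSet_eq, ← M_vvec E hE c hc0 hc1 I, Matrix.dotProduct_mulVec,
    Matrix.dotProduct_mulVec, pr_vecMul E hE c hc0 hc1, hM, Matrix.vecMul_add,
    pr_vecMul Et hEt c hc0 hc1, add_dotProduct, Matrix.vecMul_smul, Matrix.vecMul_vecMulVec]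
  simp [mul_assoc]

/-- Theorem 5: if `E` and `Ẽ` differ only in the links starting from node `i`, then
`π̃ᵀ e_I > πᵀ e_I ↔ δᵀ v > 0` and `π̃ᵀ e_I = πᵀ e_I ↔ δᵀ v = 0`. -/
theorem stmt6 {n : ℕ} (hn : 1 ≤ n) (E Et : Finset (Fin n × Fin n))
    (hE : ∀ i, 0 < outdeg E i) (hEt : ∀ i, 0 < outdeg Et i)
    (c : ℝ) (hc0 : 0 < c) (hc1 : c < 1)
    (z : Fin n → ℝ) (hz : ∀ i, 0 < z i) (hz1 : ∑ i, z i = 1)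
    (I : Finset (Fin n)) (i : Fin n)
    (hdiff : ∀ k, k ≠ i → ∀ j, ((k, j) ∈ E ↔ (k, j) ∈ Et)) :
    (prSet c z E I < prSet c z Et I ↔ 0 < delta E Et i ⬝ᵥ vvec c E I) ∧
    (prSet c z Et I = prSet c z E I ↔ delta E Et i ⬝ᵥ vvec c E I = 0) := by
  have h := prSet_diff E Et hE hEt c hc0 hc1 z I i hdiff
  have hp : 0 < c * pr c z Et i := mul_pos hc0 (pr_pos Et hEt c hc0 hc1 z hz i)
  rw [h]
  constructor
  · rw [lt_add_iff_pos_right, mul_pos_iff_of_pos_left hp]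
  · rw [add_eq_left, mul_eq_zero, or_iff_right hp.ne']
end
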